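/- Let 1 < p < ∞ and let w be a weight that is dyadically doubling, i.e. its dyadic doubling constant 𝒟^d(w) := sup_{I ∈ 𝒟} ⟨w⟩_{F(I)}/⟨w⟩_I is finite, where F(I) is the dyadic parent of I. Then there exists a positive constant c_d, depending only on p and on 𝒟^d(w), such that c_d ( [w]_{A_p^d}^{1/(p−1)} − 1 ) ≤ [w]_{A_p^{d,B}}, where [w]_{A_p^d} := sup_{J ∈ 𝒟} ⟨w⟩_J ⟨w^{−1/(p−1)}⟩_J^{p−1} and [w]_{A_p^{d,B}} := inf { Q > 0 : for every J ∈ 𝒟, (1/|J|) Σ_{I ∈ 𝒟(J)} (Δ_I w / ⟨w⟩_I)² ⟨w⟩_I^{−1/(p−1)} |I| ≤ Q ⟨w⟩_J^{−1/(p−1)} }. -/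

import Mathlib

open MeasureTheory Real
open scoped ENNReal

noncomputable section

/-- The average `⟨w⟩_{[a,b]} = (b-a)⁻¹ ∫_a^b w`. -/
def avg (w : ℝ → ℝ) (a b : ℝ) : ℝ := (b - a)⁻¹ * ∫ x in a..b, w x

/-- A weight: a locally integrable function on `ℝ` that is positive almost everywhere. -/
def IsWeight (w : ℝ → ℝ) : Prop :=
  LocallyIntegrable w volume ∧ ∀ᵐ x : ℝ, 0 < w x

/-- Endpoints of the `k`-th subinterval of `[a,b]` at bisection level `n`; as `n, k` range over
`n : ℕ`, `k < 2^n` these enumerate the family `𝒟(J)` obtained from `J = [a,b]` by repeated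
bisection (including `J` itself, for `n = 0`). -/
def subInt (a b : ℝ) (n k : ℕ) : ℝ × ℝ :=
  (a + k * ((b - a) / 2 ^ n), a + (k + 1) * ((b - a) / 2 ^ n))

/-- Midpoint of an interval. -/
def mid (a b : ℝ) : ℝ := (a + b) / 2

/-- `Δ_I w` for `I = [a,b]`: the difference of the averages of `w` over the two halves of `I`. -/
def delta (w : ℝ → ℝ) (a b : ℝ) : ℝ := avg w a (mid a b) - avg w (mid a b) b

/-- `(1/|J|) Σ_{I ∈ 𝒟(J)} (Δ_I w)² g(⟨w⟩_I) |I|` for `J = [a,b]`. -/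
def bellmanSum (w : ℝ → ℝ) (a b : ℝ) (g : ℝ → ℝ) : ℝ :=
  (b - a)⁻¹ * ∑' n : ℕ, ∑ k ∈ Finset.range (2 ^ n),
    delta w (subInt a b n k).1 (subInt a b n k).2 ^ 2 *
      g (avg w (subInt a b n k).1 (subInt a b n k).2) * ((b - a) / 2 ^ n)

/-- `(1/|J|) Σ_{I ∈ 𝒟(J)} (Δ_I w / ⟨w⟩_I)² g(⟨w⟩_I) |I|` for `J = [a,b]`. -/
def buckleySum (w : ℝ → ℝ) (a b : ℝ) (g : ℝ → ℝ) : ℝ :=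
  (b - a)⁻¹ * ∑' n : ℕ, ∑ k ∈ Finset.range (2 ^ n),
    (delta w (subInt a b n k).1 (subInt a b n k).2 /
        avg w (subInt a b n k).1 (subInt a b n k).2) ^ 2 *
      g (avg w (subInt a b n k).1 (subInt a b n k).2) * ((b - a) / 2 ^ n)

/-- `ℝ≥0∞`-valued version of `buckleySum` (the summands are nonnegative). -/
def buckleySumE (w : ℝ → ℝ) (a b : ℝ) (g : ℝ → ℝ) : ℝ≥0∞ :=
  ENNReal.ofReal ((b - a)⁻¹) * ∑' n : ℕ, ∑ k ∈ Finset.range (2 ^ n),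
    ENNReal.ofReal
      ((delta w (subInt a b n k).1 (subInt a b n k).2 /
          avg w (subInt a b n k).1 (subInt a b n k).2) ^ 2 *
        g (avg w (subInt a b n k).1 (subInt a b n k).2) * ((b - a) / 2 ^ n))

/-- `w` is doubling with constant `D` on the bisection family of `[a,b]`:
`⟨w⟩_I ≤ D ⟨w⟩_{I⁺}` and `⟨w⟩_I ≤ D ⟨w⟩_{I⁻}` for every `I ∈ 𝒟(J)` (including `I = J`). -/
def DoublingOn (D : ℝ) (w : ℝ → ℝ) (a b : ℝ) : Prop :=
  ∀ n : ℕ, ∀ k < 2 ^ n,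
    avg w (subInt a b n k).1 (subInt a b n k).2 ≤
        D * avg w (subInt a b n k).1 (mid (subInt a b n k).1 (subInt a b n k).2) ∧
      avg w (subInt a b n k).1 (subInt a b n k).2 ≤
        D * avg w (mid (subInt a b n k).1 (subInt a b n k).2) (subInt a b n k).2

/-- Endpoints of the dyadic interval `[k·2^{-j}, (k+1)·2^{-j})` of the grid `𝒟`. -/
def dyad (j k : ℤ) : ℝ × ℝ := ((k : ℝ) * (2 : ℝ) ^ (-j), ((k : ℝ) + 1) * (2 : ℝ) ^ (-j))

/-- `w` is dyadically doubling with constant `D`: the average over any dyadic interval is at most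
`D` times the average over each of its two dyadic children, i.e. `⟨w⟩_{F(I)} ≤ D ⟨w⟩_I` for every
`I ∈ 𝒟` with dyadic parent `F(I)`. -/
def DyadicDoubling (D : ℝ) (w : ℝ → ℝ) : Prop :=
  ∀ j k : ℤ,
    avg w (dyad j k).1 (dyad j k).2 ≤
        D * avg w (dyad (j + 1) (2 * k)).1 (dyad (j + 1) (2 * k)).2 ∧
      avg w (dyad j k).1 (dyad j k).2 ≤
        D * avg w (dyad (j + 1) (2 * k + 1)).1 (dyad (j + 1) (2 * k + 1)).2

/-- The dyadic Muckenhoupt constant `[w]_{A_p^d} = sup_{J ∈ 𝒟} ⟨w⟩_J ⟨w^{-1/(p-1)}⟩_J^{p-1}`. -/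
def ApConst (p : ℝ) (w : ℝ → ℝ) : ℝ≥0∞ :=
  ⨆ j : ℤ, ⨆ k : ℤ, ENNReal.ofReal
    (avg w (dyad j k).1 (dyad j k).2 *
      avg (fun x => w x ^ (-1 / (p - 1))) (dyad j k).1 (dyad j k).2 ^ (p - 1))

/-- The dyadic Buckley Muckenhoupt constant `[w]_{A_p^{d,B}}`. -/
def ApBuckleyConst (p : ℝ) (w : ℝ → ℝ) : ℝ≥0∞ :=
  sInf {Q : ℝ≥0∞ | 0 < Q ∧ ∀ j k : ℤ,
    buckleySumE w (dyad j k).1 (dyad j k).2 (fun x => x ^ (-1 / (p - 1))) ≤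
      Q * ENNReal.ofReal (avg w (dyad j k).1 (dyad j k).2 ^ (-1 / (p - 1)))}

theorem one_sub_mul_le_rpow_neg {s β : ℝ} (hs : 0 < s) (hβ : 0 ≤ β) :
    1 - β * (s - 1) ≤ s ^ (-β) := by
  rw [Real.rpow_def_of_pos hs]
  have h1 := Real.add_one_le_exp (Real.log s * -β)
  have h2 := mul_le_mul_of_nonneg_left (Real.log_le_sub_one_of_pos hs) hβ
  linarith

theorem rpow_neg_le_one_add_mul {s β : ℝ} (hs : 0 < s) (hβ : 0 ≤ β) :
    s ^ (-β) ≤ 1 + β * s ^ (-(β + 1)) * (1 - s) := by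
  have h := one_sub_mul_le_rpow_neg (inv_pos.2 hs) hβ
  rw [Real.inv_rpow hs.le, ← Real.rpow_neg hs.le, neg_neg] at h
  have h0 : 0 < s ^ (-β) := Real.rpow_pos_of_pos hs _
  have h1 : s ^ (-β) * s ^ β = 1 := by rw [← Real.rpow_add hs]; simp
  have h2 : s ^ (-(β + 1)) = s ^ (-β) * s⁻¹ := by
    rw [neg_add, Real.rpow_add hs, Real.rpow_neg_one]
  have h3 := mul_le_mul_of_nonneg_left h h0.le
  rw [h2]
  have h4 : s⁻¹ * s = 1 := inv_mul_cancel₀ hs.ne'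
  linear_combination h3 + h1 + β * s ^ (-β) * h4

theorem rpow_neg_le_quadratic {s α D : ℝ} (hs : 0 < s) (hα : 0 ≤ α) (hD : 1 ≤ D)
    (hDs : 1 ≤ D * s) :
    s ^ (-α) ≤ 1 - α * (s - 1) + α * (α + 1) * D ^ (α + 2) * (s - 1) ^ 2 := by
  have h1 := rpow_neg_le_one_add_mul hs hα
  have hD' : 1 ≤ D ^ (α + 2) := Real.one_le_rpow hD (by linarith)
  have hα1 : 0 ≤ α + 1 := by linarith
  rcases le_total 1 s with h | h
  · have h2 := one_sub_mul_le_rpow_neg hs hα1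
    have h3 := mul_le_mul_of_nonneg_left h2 (mul_nonneg hα (sub_nonneg.2 h))
    have h4 := mul_le_mul_of_nonneg_left hD'
      (mul_nonneg (mul_nonneg hα hα1) (sq_nonneg (s - 1)))
    linear_combination h1 + h3 + h4
  · have h2 := rpow_neg_le_one_add_mul hs hα1
    have h5 : s ^ (-(α + 1 + 1)) ≤ D ^ (α + 2) := by
      rw [Real.rpow_neg hs.le, ← Real.inv_rpow hs.le, show α + 1 + 1 = α + 2 by ring]
      apply Real.rpow_le_rpow (inv_pos.2 hs).le _ (by linarith)
      rwa [inv_le_iff_one_le_mul₀ hs]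
    have h3 := mul_le_mul_of_nonneg_left h2 (mul_nonneg hα (sub_nonneg.2 h))
    have h4 := mul_le_mul_of_nonneg_left h5
      (mul_nonneg (mul_nonneg hα hα1) (sq_nonneg (s - 1)))
    linear_combination h1 + h3 + h4

theorem rpow_neg_mean_le {x y α D : ℝ} (hx : 0 < x) (hy : 0 < y) (hα : 0 ≤ α) (hD : 1 ≤ D)
    (hDx : (x + y) / 2 ≤ D * x) (hDy : (x + y) / 2 ≤ D * y) :
    (x ^ (-α) + y ^ (-α)) / 2 ≤ ((x + y) / 2) ^ (-α) + α * (α + 1) * D ^ (α + 2) *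
      (((x - y) / ((x + y) / 2)) ^ 2 * ((x + y) / 2) ^ (-α)) := by
  obtain ⟨m, hm⟩ : ∃ m, m = (x + y) / 2 := ⟨_, rfl⟩
  rw [← hm] at hDx hDy ⊢
  have hm0 : 0 < m := by rw [hm]; positivity
  have key : ∀ z, 0 < z → m ≤ D * z → z ^ (-α) ≤ m ^ (-α) *
      (1 - α * (z / m - 1) + α * (α + 1) * D ^ (α + 2) * (z / m - 1) ^ 2) := by
    intro z hz hDz
    have h := rpow_neg_le_quadratic (div_pos hz hm0) hα hD
      (by rw [← mul_div_assoc]; exact (one_le_div hm0).2 hDz)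
    calc z ^ (-α) = m ^ (-α) * (z / m) ^ (-α) := by
          rw [← Real.mul_rpow hm0.le (div_pos hz hm0).le, mul_div_cancel₀ _ hm0.ne']
      _ ≤ _ := by gcongr
  have h1 := key x hx hDx
  have h2 := key y hy hDy
  have hP : 0 ≤ m ^ (-α) * (α * (α + 1) * D ^ (α + 2)) := by positivity
  obtain ⟨t, ht⟩ : ∃ t, t = x / m - 1 := ⟨_, rfl⟩
  have hyt : y / m - 1 = -t := by
    rw [ht]; field_simp; linarith
  have hxy : (x - y) / m = 2 * t := by
    rw [sub_div]; linarith
  rw [← ht] at h1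
  rw [hyt] at h2
  rw [hxy]
  have := mul_nonneg hP (sq_nonneg t)
  linear_combination h1 / 2 + h2 / 2 + 3 * this

theorem avg_pos {w : ℝ → ℝ} (hw : IsWeight w) {a b : ℝ} (hab : a < b) : 0 < avg w a b := by
  refine mul_pos (inv_pos.2 (sub_pos.2 hab)) ?_
  rw [intervalIntegral.integral_of_le hab.le]
  have hi : IntegrableOn w (Set.Ioc a b) :=
    (hw.1.integrableOn_isCompact isCompact_Icc).mono_set Set.Ioc_subset_Icc_self
  have hpos := ae_restrict_of_ae (s := Set.Ioc a b) hw.2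
  rw [integral_pos_iff_support_of_nonneg_ae (hpos.mono fun x hx => hx.le) hi]
  have : (volume.restrict (Set.Ioc a b)) (Function.support w) =
      (volume.restrict (Set.Ioc a b)) Set.univ := by
    apply measure_congr
    filter_upwards [hpos] with x hx
    exact propext ⟨fun _ => trivial, fun _ => hx.ne'⟩
  rw [this]
  simpa using hab

theorem avg_eq_avg_halves {w : ℝ → ℝ} (hw : IsWeight w) {a b : ℝ} (hab : a < b) :
    avg w a b = (avg w a (mid a b) + avg w (mid a b) b) / 2 := by
  have hi : ∀ c d, IntervalIntegrable w volume c d := fun c d =>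
    (hw.1.integrableOn_isCompact isCompact_uIcc).intervalIntegrable
  have h0 : b - a ≠ 0 := (sub_pos.2 hab).ne'
  unfold avg
  rw [← intervalIntegral.integral_add_adjacent_intervals (hi a (mid a b)) (hi _ b)]
  rw [show mid a b - a = (b - a) / 2 by unfold mid; ring,
    show b - mid a b = (b - a) / 2 by unfold mid; ring]
  field_simp

theorem sum_range_two_mul (f : ℕ → ℝ) (m : ℕ) :
    ∑ k ∈ Finset.range (2 * m), f k =
      ∑ k ∈ Finset.range m, (f (2 * k) + f (2 * k + 1)) := by
  induction m with
  | zero => simp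
  | succ m ih =>
    rw [Finset.sum_range_succ, ← ih, show 2 * (m + 1) = 2 * m + 1 + 1 by ring,
      Finset.sum_range_succ, Finset.sum_range_succ]
    ring

theorem subInt_fst_lt_snd {a b : ℝ} (hab : a < b) (n k : ℕ) :
    (subInt a b n k).1 < (subInt a b n k).2 := by
  have : 0 < (b - a) / 2 ^ n := div_pos (sub_pos.2 hab) (by positivity)
  simp only [subInt]
  linarith

theorem subInt_snd_sub_fst (a b : ℝ) (n k : ℕ) :
    (subInt a b n k).2 - (subInt a b n k).1 = (b - a) / 2 ^ n := by
  simp only [subInt]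
  ring

theorem subInt_succ_even (a b : ℝ) (n k : ℕ) :
    subInt a b (n + 1) (2 * k) =
      ((subInt a b n k).1, mid (subInt a b n k).1 (subInt a b n k).2) := by
  ext <;> simp only [subInt, mid] <;> push_cast <;> rw [pow_succ] <;> ring

theorem subInt_succ_odd (a b : ℝ) (n k : ℕ) :
    subInt a b (n + 1) (2 * k + 1) =
      (mid (subInt a b n k).1 (subInt a b n k).2, (subInt a b n k).2) := by
  ext <;> simp only [subInt, mid] <;> push_cast <;> rw [pow_succ] <;> ring

theorem DyadicDoubling.doublingOn {D : ℝ} {w : ℝ → ℝ} (h : DyadicDoubling D w) (j k : ℤ) :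
    DoublingOn D w (dyad j k).1 (dyad j k).2 := by
  intro n i _
  have e : ∀ l : ℤ, ((2 : ℝ) ^ (-(l + 1))) = 2 ^ (-l) / 2 := by
    intro l
    rw [neg_add, zpow_add₀ two_ne_zero]
    norm_num [div_eq_mul_inv]
  have e1 : subInt (dyad j k).1 (dyad j k).2 n i = dyad (j + n) (2 ^ n * k + i) := by
    have e2 : (2 : ℝ) ^ (-(j + n : ℤ)) = 2 ^ (-j) / 2 ^ n := by
      rw [neg_add, zpow_add₀ two_ne_zero, zpow_neg _ (n : ℤ), zpow_natCast, div_eq_mul_inv]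
    ext <;> simp only [subInt, dyad, e2] <;> push_cast <;> field_simp <;> ring
  rw [e1]
  have := h (j + n) (2 ^ n * k + i)
  generalize j + (n : ℤ) = l at *
  generalize 2 ^ n * k + (i : ℤ) = q at *
  convert this using 3 <;> simp only [mid, dyad, e] <;> push_cast <;> ring_nf

theorem level_sum_succ_le {w : ℝ → ℝ} (hw : IsWeight w) {a b : ℝ} (hab : a < b) {D α : ℝ}
    (hD : 1 ≤ D) (hα : 0 ≤ α) (hdoub : DoublingOn D w a b) (n : ℕ) :
    ∑ k ∈ Finset.range (2 ^ (n + 1)),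
        avg w (subInt a b (n + 1) k).1 (subInt a b (n + 1) k).2 ^ (-α) *
          ((b - a) / 2 ^ (n + 1)) ≤
      ∑ k ∈ Finset.range (2 ^ n),
        avg w (subInt a b n k).1 (subInt a b n k).2 ^ (-α) * ((b - a) / 2 ^ n) +
      α * (α + 1) * D ^ (α + 2) * ∑ k ∈ Finset.range (2 ^ n),
        (delta w (subInt a b n k).1 (subInt a b n k).2 /
            avg w (subInt a b n k).1 (subInt a b n k).2) ^ 2 *
          avg w (subInt a b n k).1 (subInt a b n k).2 ^ (-α) * ((b - a) / 2 ^ n) := by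
  rw [pow_succ' 2 n, sum_range_two_mul, Finset.mul_sum, ← Finset.sum_add_distrib]
  refine Finset.sum_le_sum fun k hk => ?_
  rw [subInt_succ_even, subInt_succ_odd]
  have hlt := subInt_fst_lt_snd hab n k
  obtain ⟨h1, h2⟩ := hdoub n k (Finset.mem_range.1 hk)
  generalize (subInt a b n k).1 = c at *
  generalize (subInt a b n k).2 = d at *
  have hc : c < mid c d := by unfold mid; linarith
  have hd : mid c d < d := by unfold mid; linarith
  rw [avg_eq_avg_halves hw hlt] at h1 h2 ⊢
  have key := rpow_neg_mean_le (avg_pos hw hc) (avg_pos hw hd) hα hD h1 h2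
  have hpos : 0 ≤ (b - a) / 2 ^ n := div_nonneg (sub_nonneg.2 hab.le) (by positivity)
  have := mul_le_mul_of_nonneg_right key hpos
  unfold delta
  refine le_of_eq_of_le ?_ (this.trans_eq (by ring))
  simp only
  rw [pow_succ]
  ring

theorem level_sum_le {w : ℝ → ℝ} (hw : IsWeight w) {a b : ℝ} (hab : a < b) {D α q : ℝ}
    (hD : 1 ≤ D) (hα : 0 ≤ α) (hq : 0 ≤ q) (hdoub : DoublingOn D w a b)
    (hB : buckleySumE w a b (fun x => x ^ (-α)) ≤
      ENNReal.ofReal q * ENNReal.ofReal (avg w a b ^ (-α))) (n : ℕ) :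
    ∑ k ∈ Finset.range (2 ^ n),
        avg w (subInt a b n k).1 (subInt a b n k).2 ^ (-α) * ((b - a) / 2 ^ n) ≤
      (b - a) * avg w a b ^ (-α) * (1 + α * (α + 1) * D ^ (α + 2) * q) := by
  have hba : 0 < b - a := sub_pos.2 hab
  have hA : ∀ n k, 0 < avg w (subInt a b n k).1 (subInt a b n k).2 := fun n k =>
    avg_pos hw (subInt_fst_lt_snd hab n k)
  set t : ℕ → ℕ → ℝ := fun n k => (delta w (subInt a b n k).1 (subInt a b n k).2 /
      avg w (subInt a b n k).1 (subInt a b n k).2) ^ 2 *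
        avg w (subInt a b n k).1 (subInt a b n k).2 ^ (-α) * ((b - a) / 2 ^ n) with ht
  have ht0 : ∀ n k, 0 ≤ t n k := fun n k =>
    mul_nonneg (mul_nonneg (sq_nonneg _) (Real.rpow_nonneg (hA n k).le _)) (by positivity)
  have hsum : ∀ n, ∑ m ∈ Finset.range n, ∑ k ∈ Finset.range (2 ^ m), t m k ≤
      (b - a) * avg w a b ^ (-α) * q := by
    intro n
    have h1 : ENNReal.ofReal ((b - a)⁻¹ *
        ∑ m ∈ Finset.range n, ∑ k ∈ Finset.range (2 ^ m), t m k) ≤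
        ENNReal.ofReal (q * avg w a b ^ (-α)) := by
      rw [ENNReal.ofReal_mul (inv_nonneg.2 hba.le), ENNReal.ofReal_mul hq]
      refine le_trans ?_ hB
      unfold buckleySumE
      gcongr
      rw [ENNReal.ofReal_sum_of_nonneg fun m _ => Finset.sum_nonneg fun k _ => ht0 m k]
      refine le_trans (Finset.sum_le_sum fun m _ => ?_) (ENNReal.sum_le_tsum (Finset.range n))
      rw [ENNReal.ofReal_sum_of_nonneg fun k _ => ht0 m k]
    rw [ENNReal.ofReal_le_ofReal_iff
      (mul_nonneg hq (Real.rpow_nonneg (avg_pos hw hab).le _)), inv_mul_le_iff₀ hba] at h1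
    linarith
  have hS : ∀ n, ∑ k ∈ Finset.range (2 ^ n),
      avg w (subInt a b n k).1 (subInt a b n k).2 ^ (-α) * ((b - a) / 2 ^ n) ≤
      (b - a) * avg w a b ^ (-α) + α * (α + 1) * D ^ (α + 2) *
        ∑ m ∈ Finset.range n, ∑ k ∈ Finset.range (2 ^ m), t m k := by
    intro n
    induction n with
    | zero => simp [subInt, mul_comm]
    | succ n ih =>
      rw [Finset.sum_range_succ]
      have := level_sum_succ_le hw hab hD hα hdoub n
      linarith
  have hK : 0 ≤ α * (α + 1) * D ^ (α + 2) := by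
    have : 0 ≤ D := by linarith
    positivity
  have h1 := mul_le_mul_of_nonneg_left (hsum n) hK
  linarith [hS n]

/-- On a.e. point of an interval, the averages over the bisection intervals containing the point
converge to the value of the function. -/
theorem ae_tendsto_avg_subInt {w : ℝ → ℝ} (hw : LocallyIntegrable w volume) {a b : ℝ}
    (hab : a < b) :
    ∀ᵐ x : ℝ, x ∈ Set.Ioc a b → ∃ k : ℕ → ℕ, (∀ n, k n < 2 ^ n ∧
        x ∈ Set.Ico (subInt a b n (k n)).1 (subInt a b n (k n)).2) ∧
      Filter.Tendsto (fun n => avg w (subInt a b n (k n)).1 (subInt a b n (k n)).2)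
        Filter.atTop (nhds (w x)) := by
  have hba : 0 < b - a := sub_pos.2 hab
  have hne : ∀ᵐ x : ℝ, x ≠ b := by simp [ae_iff]
  filter_upwards [IsUnifLocDoublingMeasure.ae_tendsto_average volume hw 1, hne] with x hx hxb hxI
  have hh : ∀ n : ℕ, 0 < (b - a) / 2 ^ n := fun n => by positivity
  set k : ℕ → ℕ := fun n => ⌊(x - a) / ((b - a) / 2 ^ n)⌋₊ with hk
  have hmem : ∀ n, k n < 2 ^ n ∧
      x ∈ Set.Ico (subInt a b n (k n)).1 (subInt a b n (k n)).2 := by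
    intro n
    have h0 : 0 ≤ (x - a) / ((b - a) / 2 ^ n) :=
      div_nonneg (sub_nonneg.2 hxI.1.le) (hh n).le
    have hx_lt : x < b := lt_of_le_of_ne hxI.2 hxb
    refine ⟨?_, ?_, ?_⟩
    · rw [hk, Nat.floor_lt h0, div_lt_iff₀ (hh n)]
      push_cast
      rw [mul_div_cancel₀ _ (by positivity)]
      linarith
    · have := Nat.floor_le h0
      rw [le_div_iff₀ (hh n)] at this
      simp only [subInt, hk]
      linarith
    · have := Nat.lt_floor_add_one ((x - a) / ((b - a) / 2 ^ n))
      rw [div_lt_iff₀ (hh n)] at this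
      simp only [subInt, hk]
      linarith
  refine ⟨k, hmem, ?_⟩
  have hlim : Filter.Tendsto (fun n : ℕ => (b - a) / 2 ^ n / 2) Filter.atTop
      (nhdsWithin 0 (Set.Ioi 0)) := by
    refine tendsto_nhdsWithin_iff.2 ⟨?_, Filter.Eventually.of_forall fun n => half_pos (hh n)⟩
    have := (tendsto_pow_atTop_nhds_zero_of_lt_one (r := (1 / 2 : ℝ)) (by norm_num)
      (by norm_num)).const_mul ((b - a) / 2)
    rw [mul_zero] at this
    refine this.congr fun n => ?_
    rw [one_div, inv_pow]
    ring
  have hball : ∀ n, Metric.closedBall (mid (subInt a b n (k n)).1 (subInt a b n (k n)).2)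
      ((b - a) / 2 ^ n / 2) = Set.Icc (subInt a b n (k n)).1 (subInt a b n (k n)).2 := by
    intro n
    rw [Real.closedBall_eq_Icc, ← subInt_snd_sub_fst a b n (k n)]
    congr 1 <;> unfold mid <;> ring
  have := hx (fun n => mid (subInt a b n (k n)).1 (subInt a b n (k n)).2)
    (fun n : ℕ => (b - a) / 2 ^ n / 2) hlim (Filter.Eventually.of_forall fun n => by
      rw [one_mul, hball]
      exact Set.Ico_subset_Icc_self (hmem n).2)
  refine this.congr fun n => ?_
  have hlt := subInt_fst_lt_snd hab n (k n)
  rw [hball, setAverage_eq, integral_Icc_eq_integral_Ioc, avg,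
    intervalIntegral.integral_of_le hlt.le, Real.volume_real_Icc_of_le hlt.le, smul_eq_mul]

theorem lintegral_rpow_neg_le {w : ℝ → ℝ} (hw : IsWeight w) {a b : ℝ} (hab : a < b) {α M : ℝ}
    (hM : ∀ n : ℕ, ∑ k ∈ Finset.range (2 ^ n),
      avg w (subInt a b n k).1 (subInt a b n k).2 ^ (-α) * ((b - a) / 2 ^ n) ≤ M) :
    ∫⁻ x in Set.Ioc a b, ENNReal.ofReal (w x ^ (-α)) ≤ ENNReal.ofReal M := by
  set F : ℕ → ℝ → ℝ≥0∞ := fun n x => ∑ k ∈ Finset.range (2 ^ n),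
    (Set.Ico (subInt a b n k).1 (subInt a b n k).2).indicator (fun _ =>
      ENNReal.ofReal (avg w (subInt a b n k).1 (subInt a b n k).2 ^ (-α))) x with hF
  have hFm : ∀ n, Measurable (F n) := fun n =>
    Finset.measurable_sum _ fun k _ => measurable_const.indicator measurableSet_Ico
  have hFint : ∀ n, ∫⁻ x in Set.Ioc a b, F n x ≤ ENNReal.ofReal M := by
    intro n
    refine (setLIntegral_le_lintegral _ _).trans ?_
    rw [hF, lintegral_finsetSum _ fun k _ => measurable_const.indicator measurableSet_Ico]
    refine le_trans (le_of_eq ?_) (ENNReal.ofReal_le_ofReal (hM n))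
    have h0 : ∀ k, 0 ≤ avg w (subInt a b n k).1 (subInt a b n k).2 ^ (-α) := fun k =>
      Real.rpow_nonneg (avg_pos hw (subInt_fst_lt_snd hab n k)).le _
    have hh : 0 ≤ (b - a) / 2 ^ n := div_nonneg (sub_nonneg.2 hab.le) (by positivity)
    rw [ENNReal.ofReal_sum_of_nonneg fun k _ => mul_nonneg (h0 k) hh]
    refine Finset.sum_congr rfl fun k _ => ?_
    rw [lintegral_indicator_const measurableSet_Ico, Real.volume_Ico, subInt_snd_sub_fst,
      ENNReal.ofReal_mul (h0 k)]
  calc ∫⁻ x in Set.Ioc a b, ENNReal.ofReal (w x ^ (-α))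
      ≤ ∫⁻ x in Set.Ioc a b, Filter.liminf (fun n => F n x) Filter.atTop := by
        refine lintegral_mono_ae ?_
        rw [ae_restrict_iff' measurableSet_Ioc]
        filter_upwards [ae_tendsto_avg_subInt hw.1 hab, hw.2] with x hx hx0 hxI
        obtain ⟨k, hk, hlim⟩ := hx hxI
        have h1 := ENNReal.tendsto_ofReal (hlim.rpow_const (p := -α) (Or.inl hx0.ne'))
        rw [← h1.liminf_eq]
        refine Filter.liminf_le_liminf (Filter.Eventually.of_forall fun n => ?_)
        refine le_trans (le_of_eq ?_) (Finset.single_le_sum (fun _ _ => zero_le)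
          (Finset.mem_range.2 (hk n).1))
        rw [Set.indicator_of_mem (hk n).2]
    _ ≤ Filter.liminf (fun n => ∫⁻ x in Set.Ioc a b, F n x) Filter.atTop :=
        lintegral_liminf_le hFm
    _ ≤ ENNReal.ofReal M := by
        refine (Filter.liminf_le_liminf (Filter.Eventually.of_forall hFint)).trans ?_
        simp

theorem avg_rpow_neg_le {w : ℝ → ℝ} (hw : IsWeight w) {a b : ℝ} (hab : a < b) {D α q : ℝ}
    (hD : 1 ≤ D) (hα : 0 ≤ α) (hq : 0 ≤ q) (hdoub : DoublingOn D w a b)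
    (hB : buckleySumE w a b (fun x => x ^ (-α)) ≤
      ENNReal.ofReal q * ENNReal.ofReal (avg w a b ^ (-α))) :
    avg (fun x => w x ^ (-α)) a b ≤
      avg w a b ^ (-α) * (1 + α * (α + 1) * D ^ (α + 2) * q) := by
  have hba : 0 < b - a := sub_pos.2 hab
  have h := lintegral_rpow_neg_le hw hab (level_sum_le hw hab hD hα hq hdoub hB)
  have hD0 : 0 ≤ D := by linarith
  have hA := Real.rpow_nonneg (avg_pos hw hab).le (-α)
  rw [avg, inv_mul_le_iff₀ hba, ← mul_assoc, intervalIntegral.integral_of_le hab.le,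
    integral_eq_lintegral_of_nonneg_ae]
  · exact ENNReal.toReal_le_of_le_ofReal (by positivity) h
  · filter_upwards [ae_restrict_of_ae hw.2] with x hx using Real.rpow_nonneg hx.le _
  · exact (hw.1.aestronglyMeasurable.aemeasurable.pow_const _).aestronglyMeasurable.restrict

theorem dyad_fst_lt_snd (j k : ℤ) : (dyad j k).1 < (dyad j k).2 := by
  have : (0 : ℝ) < 2 ^ (-j) := by positivity
  simp only [dyad]
  linarith

theorem DyadicDoubling.mono {D D' : ℝ} {w : ℝ → ℝ} (hw : IsWeight w) (h : DyadicDoubling D w)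
    (hD : D ≤ D') : DyadicDoubling D' w := fun j k =>
  ⟨(h j k).1.trans (mul_le_mul_of_nonneg_right hD (avg_pos hw (dyad_fst_lt_snd _ _)).le),
    (h j k).2.trans (mul_le_mul_of_nonneg_right hD (avg_pos hw (dyad_fst_lt_snd _ _)).le)⟩

/-- Theorem II.7, part (5), dyadic case: for dyadically doubling weights,
`c_d([w]_{A_p^d}^{1/(p-1)} − 1) ≤ [w]_{A_p^{d,B}}`. -/
theorem ap_buckley_lower (p : ℝ) (hp : 1 < p) (D : ℝ) :
    ∃ c : ℝ, 0 < c ∧ ∀ w : ℝ → ℝ, IsWeight w → DyadicDoubling D w →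
      ENNReal.ofReal c * (ApConst p w ^ (1 / (p - 1)) - 1) ≤ ApBuckleyConst p w := by

  have hp1 : 0 < p - 1 := sub_pos.2 hp
  obtain ⟨α, hα⟩ : ∃ α, α = 1 / (p - 1) := ⟨_, rfl⟩
  have hα0 : 0 < α := hα ▸ one_div_pos.2 hp1
  have hneg : -1 / (p - 1) = -α := by rw [hα, neg_div]
  have hαp : α * (p - 1) = 1 := by rw [hα]; field_simp
  set C : ℝ := α * (α + 1) * max D 1 ^ (α + 2) with hC
  have hC0 : 0 < C := by positivity
  refine ⟨C⁻¹, inv_pos.2 hC0, fun w hw hdoub => le_sInf ?_⟩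
  rintro Q ⟨-, hQ⟩
  rcases eq_or_ne Q ⊤ with rfl | hQt
  · exact le_top
  obtain ⟨q, hq⟩ : ∃ q, q = Q.toReal := ⟨_, rfl⟩
  have hq0 : 0 ≤ q := hq ▸ ENNReal.toReal_nonneg
  obtain rfl : Q = ENNReal.ofReal q := by rw [hq, ENNReal.ofReal_toReal hQt]
  have hR : 0 < 1 + C * q := by positivity
  have hAp : ApConst p w ≤ ENNReal.ofReal ((1 + C * q) ^ (p - 1)) := by
    refine iSup_le fun j => iSup_le fun k => ENNReal.ofReal_le_ofReal ?_
    have hlt := dyad_fst_lt_snd j k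
    have hQ' := hQ j k
    rw [hneg] at hQ' ⊢
    have hav := avg_rpow_neg_le hw hlt (le_max_right D 1) hα0.le hq0
      ((hdoub.mono hw (le_max_left D 1)).doublingOn j k) hQ'
    have hA := avg_pos hw hlt
    have hB : 0 ≤ avg (fun x => w x ^ (-α)) (dyad j k).1 (dyad j k).2 := by
      refine mul_nonneg (inv_nonneg.2 (sub_nonneg.2 hlt.le)) ?_
      exact intervalIntegral.integral_nonneg_of_ae hlt.le
        (hw.2.mono fun x hx => Real.rpow_nonneg hx.le _)
    generalize avg w (dyad j k).1 (dyad j k).2 = A at *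
    calc _ ≤ A * (A ^ (-α) * (1 + C * q)) ^ (p - 1) := by gcongr
      _ = (1 + C * q) ^ (p - 1) := by
        rw [Real.mul_rpow (Real.rpow_nonneg hA.le _) hR.le, ← Real.rpow_mul hA.le, neg_mul,
          hαp, Real.rpow_neg_one, ← mul_assoc, mul_inv_cancel₀ hA.ne', one_mul]
  have hpow : ApConst p w ^ (1 / (p - 1)) ≤ ENNReal.ofReal (1 + C * q) := by
    rw [← hα]
    refine (ENNReal.rpow_le_rpow hAp hα0.le).trans_eq ?_
    rw [ENNReal.ofReal_rpow_of_nonneg (Real.rpow_nonneg hR.le _) hα0.le, ← Real.rpow_mul hR.le,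
      mul_comm (p - 1), hαp, Real.rpow_one]
  calc ENNReal.ofReal C⁻¹ * (ApConst p w ^ (1 / (p - 1)) - 1)
      ≤ ENNReal.ofReal C⁻¹ * ENNReal.ofReal (C * q) := by
        gcongr
        rw [tsub_le_iff_left, ← ENNReal.ofReal_one,
          ← ENNReal.ofReal_add zero_le_one (mul_nonneg hC0.le hq0)]
        exact hpow
    _ = ENNReal.ofReal q := by
        rw [← ENNReal.ofReal_mul (inv_nonneg.2 hC0.le), inv_mul_cancel_left₀ hC0.ne']
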